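/- arXiv:1208.0813 — 2 statements merged into one kernel-verified Lean document; each statement's English description precedes it below -/
import Mathlib

section
/- For every integer n ≥ 2 and every integer m with 1 ≤ m ≤ 2n−2, every choice of n full infinite words π_1,…,π_n over the alphabet {1,…,m} is a losing strategy: there exists an initial configuration from which there is an infinite run of immediate-scheduler steps. -/
/-- A step of the immediate scheduler for infinite words: a nonempty set `S` of
players, each in conflict, has its positions increased by one; others stay put. -/
def IStep {n m : ℕ} (π : Fin n → ℕ → Fin m) (c c' : Fin n → ℕ) : Prop :=
  ∃ S : Finset (Fin n), S.Nonempty ∧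
    (∀ i ∈ S, ∃ j, j ≠ i ∧ π j (c j) = π i (c i)) ∧
    (∀ i ∈ S, c' i = c i + 1) ∧
    (∀ i ∉ S, c' i = c i)

namespace MC

open Finset

/-- Weight of a chair class with `q` occupants, `u` of which stay. -/
def fw (q u : ℕ) : ZMod 2 := if u = 0 then (q : ZMod 2) + 1 else if u = 1 then 1 else 0

lemma fw_marg (q u : ℕ) : fw (q + 1) u + fw (q + 1) (u + 1) = fw q u := by
  have h2 : (1 : ZMod 2) + 1 = 0 := by decide
  unfold fw
  rcases u with _ | _ | u
  · simp only [if_true]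
    push_cast
    norm_num
    linear_combination h2
  · simp
  · simp

lemma fw_self {q : ℕ} (h : q ≤ 1) : fw q q = 1 := by
  interval_cases q <;> simp [fw]

lemma fw_self_zero {q : ℕ} (h : 2 ≤ q) : fw q q = 0 := by
  unfold fw
  rw [if_neg (by omega), if_neg (by omega)]

lemma fw_one_zero : fw 1 0 = 0 := by decide

section

variable {n : ℕ} {C : Type} [Fintype C] [DecidableEq C]

/-- Class of players of `P` on chair `a`. -/
def cls (x : Fin n → C) (P : Finset (Fin n)) (a : C) : Finset (Fin n) := P.filter (fun j => x j = a)

/-- Weight of a move. -/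
def wt (x : Fin n → C) (P S : Finset (Fin n)) : ZMod 2 :=
  ∏ a : C, fw (cls x P a).card (cls x (P \ S) a).card

/-- Injectivity on `P`. -/
def term (x : Fin n → C) (P : Finset (Fin n)) : Prop :=
  ∀ i ∈ P, ∀ j ∈ P, x i = x j → i = j

lemma wt_conf (x : Fin n → C) (P S : Finset (Fin n)) (hS : S ⊆ P) (hw : wt x P S ≠ 0) :
    ∀ i ∈ S, ∃ j ∈ P, j ≠ i ∧ x j = x i := by
  intro i hi
  by_contra hcon
  push Not at hcon
  apply hw
  apply Finset.prod_eq_zero (Finset.mem_univ (x i))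
  have h1 : cls x P (x i) = {i} := by
    ext j
    simp only [cls, mem_filter, mem_singleton]
    constructor
    · rintro ⟨hj, hx⟩
      by_contra hne
      exact hcon j hj hne hx
    · rintro rfl
      exact ⟨hS hi, rfl⟩
  have h2 : cls x (P \ S) (x i) = ∅ := by
    ext j
    simp only [cls, mem_filter, mem_sdiff, notMem_empty, iff_false]
    rintro ⟨⟨hj, hjS⟩, hx⟩
    by_cases hne : j = i
    · subst hne; exact hjS hi
    · exact hcon j hj hne hx
  rw [h1, h2]
  simpa using fw_one_zero

lemma wt_empty_nonterm (x : Fin n → C) (P : Finset (Fin n)) (h : ¬ term x P) : wt x P ∅ = 0 := by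
  unfold term at h
  push Not at h
  obtain ⟨i, hi, j, hj, hx, hne⟩ := h
  apply Finset.prod_eq_zero (Finset.mem_univ (x i))
  rw [sdiff_empty]
  apply fw_self_zero
  have : ({i, j} : Finset (Fin n)) ⊆ cls x P (x i) := by
    intro k hk
    simp only [mem_insert, mem_singleton] at hk
    rcases hk with rfl | rfl
    · simp [cls, hi]
    · simp [cls, hj, hx]
  calc 2 = ({i, j} : Finset (Fin n)).card := (card_pair hne).symm
    _ ≤ _ := card_le_card this

lemma wt_empty_term (x : Fin n → C) (P : Finset (Fin n)) (h : term x P) : wt x P ∅ = 1 := by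
  apply Finset.prod_eq_one
  intro a _
  rw [sdiff_empty]
  apply fw_self
  rw [card_le_one]
  intro i hi j hj
  simp only [cls, mem_filter] at hi hj
  exact h i hi.1 j hj.1 (hi.2.trans hj.2.symm)

lemma wt_term (x : Fin n → C) (P S : Finset (Fin n)) (hS : S ⊆ P) (h : term x P)
    (hne : S ≠ ∅) : wt x P S = 0 := by
  by_contra hw
  obtain ⟨i, hi⟩ := Finset.nonempty_iff_ne_empty.mpr hne
  obtain ⟨j, hj, hji, hx⟩ := wt_conf x P S hS hw i hi
  exact hji (h j hj i (hS hi) hx)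

lemma wt_congr (x y : Fin n → C) (P S : Finset (Fin n)) (h : ∀ j ∈ P, x j = y j) :
    wt x P S = wt y P S := by
  have key : ∀ Q ⊆ P, ∀ a, cls x Q a = cls y Q a := by
    intro Q hQ a
    apply filter_congr
    intro j hj
    rw [h j (hQ hj)]
  unfold wt
  apply prod_congr rfl
  intro a _
  rw [key P (Subset.refl _), key _ sdiff_subset]

lemma wt_marg (x : Fin n → C) (i : Fin n) (S : Finset (Fin n)) (hi : i ∉ S) :
    wt x univ S + wt x univ (insert i S) = wt x (univ.erase i) S := by
  unfold wt
  rw [← mul_prod_erase univ _ (mem_univ (x i)), ← mul_prod_erase univ _ (mem_univ (x i)),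
    ← mul_prod_erase univ _ (mem_univ (x i))]
  have e1 : ∀ a ∈ univ.erase (x i), cls x (univ.erase i) a = cls x univ a := by
    intro a ha
    ext j
    simp only [cls, mem_filter, mem_erase, mem_univ, and_true, true_and] at ha ⊢
    constructor
    · exact fun h => h.2
    · intro h
      refine ⟨?_, h⟩
      rintro rfl
      exact ha h.symm
  have e2 : ∀ a ∈ univ.erase (x i), cls x (univ \ S) a = cls x (univ.erase i \ S) a := by
    intro a ha
    ext j
    simp only [cls, mem_filter, mem_erase, mem_univ, and_true, true_and, mem_sdiff] at ha ⊢
    constructor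
    · rintro ⟨h1, h⟩
      refine ⟨⟨?_, h1⟩, h⟩
      rintro rfl
      exact ha h.symm
    · exact fun h => ⟨h.1.2, h.2⟩
  have e3 : ∀ a, cls x (univ \ insert i S) a = cls x (univ.erase i \ S) a := by
    intro a
    congr 1
    ext j
    simp [not_or]
  have e4 : (cls x univ (x i)).card = (cls x (univ.erase i) (x i)).card + 1 := by
    have : cls x univ (x i) = insert i (cls x (univ.erase i) (x i)) := by
      ext j
      simp only [cls, mem_filter, mem_erase, mem_univ, and_true, true_and, mem_insert]
      by_cases hj : j = i
      · simp [hj]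
      · simp [hj]
    rw [this, card_insert_of_notMem (by simp [cls])]
  have e5 : (cls x (univ \ S) (x i)).card = (cls x (univ.erase i \ S) (x i)).card + 1 := by
    have : cls x (univ \ S) (x i) = insert i (cls x (univ.erase i \ S) (x i)) := by
      ext j
      simp only [cls, mem_filter, mem_erase, mem_univ, and_true, true_and, mem_insert, mem_sdiff]
      by_cases hj : j = i
      · simp [hj, hi]
      · simp [hj]
    rw [this, card_insert_of_notMem (by simp [cls])]
  have p1 : ∏ a ∈ univ.erase (x i), fw (cls x univ a).card (cls x (univ \ S) a).card
      = ∏ a ∈ univ.erase (x i), fw (cls x (univ.erase i) a).card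
        (cls x (univ.erase i \ S) a).card := by
    apply prod_congr rfl
    intro a ha
    rw [e1 a ha, e2 a ha]
  have p2 : ∏ a ∈ univ.erase (x i), fw (cls x univ a).card (cls x (univ \ insert i S) a).card
      = ∏ a ∈ univ.erase (x i), fw (cls x (univ.erase i) a).card
        (cls x (univ.erase i \ S) a).card := by
    apply prod_congr rfl
    intro a ha
    rw [e1 a ha, e3 a]
  rw [p1, p2, e3, e4, e5, ← add_mul, add_comm (fw _ _), fw_marg]

/-- Moving the players in `S`. -/
def mv (c : Fin n → ℕ) (S : Finset (Fin n)) : Fin n → ℕ := fun j => if j ∈ S then c j + 1 else c j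

/-- The chairs of a configuration. -/
def ch (π : Fin n → ℕ → C) (c : Fin n → ℕ) : Fin n → C := fun j => π j (c j)

/-- A step in a general chair type. -/
def St (π : Fin n → ℕ → C) (c c' : Fin n → ℕ) : Prop :=
  ∃ S : Finset (Fin n), S.Nonempty ∧ (∀ i ∈ S, ∃ j, j ≠ i ∧ π j (c j) = π i (c i)) ∧ c' = mv c S

lemma st_of_wt (π : Fin n → ℕ → C) (c : Fin n → ℕ) (P S : Finset (Fin n)) (hS : S ⊆ P)
    (hw : wt (ch π c) P S ≠ 0) (hne : S ≠ ∅) : St π c (mv c S) := by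
  refine ⟨S, Finset.nonempty_iff_ne_empty.mpr hne, ?_, rfl⟩
  intro i hi
  obtain ⟨j, _, h1, h2⟩ := wt_conf _ P S hS hw i hi
  exact ⟨j, h1, h2⟩

lemma exists_H (π : Fin n → ℕ → C) (hwf : WellFounded (fun c' c => St π c c'))
    (P : Finset (Fin n)) (h : (Fin n → ℕ) → ZMod 2)
    (hh : ∀ c d, (∀ j ∈ P, c j = d j) → h c = h d) :
    ∃ H : (Fin n → ℕ) → ZMod 2,
      (∀ c d, (∀ j ∈ P, c j = d j) → H c = H d) ∧
      (∀ c, term (ch π c) P → H c = h c) ∧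
      (∀ c, H c = ∑ S ∈ P.powerset, wt (ch π c) P S * H (mv c S)) := by
  classical
  let H : (Fin n → ℕ) → ZMod 2 := hwf.fix (fun c rec =>
    if term (ch π c) P then h c else
      ∑ S ∈ P.powerset, wt (ch π c) P S *
        (if hs : St π c (mv c S) then rec (mv c S) hs else 0))
  have Heq : ∀ c, H c = if term (ch π c) P then h c else
      ∑ S ∈ P.powerset, wt (ch π c) P S *
        (if hs : St π c (mv c S) then H (mv c S) else 0) := by
    intro c
    exact hwf.fix_eq _ c
  have H2 : ∀ c, term (ch π c) P → H c = h c := by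
    intro c hc
    rw [Heq, if_pos hc]
  have H3 : ∀ c, H c = ∑ S ∈ P.powerset, wt (ch π c) P S * H (mv c S) := by
    intro c
    by_cases hc : term (ch π c) P
    · rw [Finset.sum_eq_single ∅]
      · rw [wt_empty_term _ _ hc, one_mul]
        congr 1
      · intro S hS hne
        rw [wt_term _ _ _ (mem_powerset.mp hS) hc hne, zero_mul]
      · intro h0
        simp at h0
    · rw [Heq, if_neg hc]
      apply sum_congr rfl
      intro S hS
      by_cases hw : wt (ch π c) P S = 0
      · rw [hw, zero_mul, zero_mul]
      · have hne : S ≠ ∅ := by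
          rintro rfl
          exact hw (wt_empty_nonterm _ _ hc)
        rw [dif_pos (st_of_wt π c P S (mem_powerset.mp hS) hw hne)]
  refine ⟨H, ?_, H2, H3⟩
  intro c
  induction c using hwf.induction with
  | _ c ih =>
    intro d hcd
    have hch : ∀ j ∈ P, ch π c j = ch π d j := by
      intro j hj
      simp only [ch, hcd j hj]
    by_cases hc : term (ch π c) P
    · have hd : term (ch π d) P := by
        intro i hi j hj hx
        rw [← hch i hi, ← hch j hj] at hx
        exact hc i hi j hj hx
      rw [H2 c hc, H2 d hd, hh c d hcd]
    · rw [H3 c, H3 d]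
      apply sum_congr rfl
      intro S hS
      rw [← wt_congr _ _ P S hch]
      by_cases hw : wt (ch π c) P S = 0
      · rw [hw, zero_mul, zero_mul]
      · have hne : S ≠ ∅ := by
          rintro rfl
          exact hw (wt_empty_nonterm _ _ hc)
        rw [ih _ (st_of_wt π c P S (mem_powerset.mp hS) hw hne) (mv d S)]
        intro j hj
        simp only [mv, hcd j hj]

lemma marg_sum (π : Fin n → ℕ → C) (i : Fin n) (H : (Fin n → ℕ) → ZMod 2)
    (H1 : ∀ c d, (∀ j ∈ univ.erase i, c j = d j) → H c = H d) (c : Fin n → ℕ) :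
    ∑ S : Finset (Fin n), wt (ch π c) univ S * H (mv c S)
      = ∑ S ∈ (univ.erase i).powerset, wt (ch π c) (univ.erase i) S * H (mv c S) := by
  rw [← Finset.powerset_univ]
  conv_lhs => rw [← Finset.insert_erase (mem_univ i)]
  rw [Finset.sum_powerset_insert (by simp), ← sum_add_distrib]
  apply sum_congr rfl
  intro S hS
  have hi : i ∉ S := fun h => by
    have := mem_powerset.mp hS h
    simp at this
  rw [H1 (mv c (insert i S)) (mv c S), ← add_mul]
  · rw [Finset.insert_erase (mem_univ i), wt_marg _ _ _ hi]
  · intro j hj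
    simp only [mem_erase, mem_univ, and_true] at hj
    simp [mv, hj]

end

lemma mono_sum (N : ℕ) (x : Fin (N + 1) → Bool) (h0 : ¬ ∀ j, x j = false)
    (h1 : ¬ ∀ j, x j = true) :
    ∑ i : Fin (N + 1), (if ∀ j ∈ univ.erase i, x j = decide (i < j) then (1 : ZMod 2) else 0) = 0 := by
  classical
  let A : ℕ → ZMod 2 := fun k => if ∀ j : Fin (N + 1), x j = decide (k ≤ (j : ℕ)) then 1 else 0
  have key : ∀ i : Fin (N + 1),
      (if ∀ j ∈ univ.erase i, x j = decide (i < j) then (1 : ZMod 2) else 0)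
        = A (i + 1) - A i := by
    intro i
    have hsub : A (i + 1) - A i = A (i + 1) + A i := CharTwo.sub_eq_add _ _
    rw [hsub]
    simp only [A]
    have a1 : (∀ j : Fin (N + 1), x j = decide ((i : ℕ) + 1 ≤ (j : ℕ))) ↔
        (∀ j ∈ univ.erase i, x j = decide (i < j)) ∧ x i = false := by
      constructor
      · intro h
        refine ⟨fun j _ => ?_, ?_⟩
        · rw [h j]; rfl
        · rw [h i]; simp
      · rintro ⟨h, hi⟩ j
        by_cases hj : j = i
        · subst hj; rw [hi]; simp
        · rw [h j (by simp [hj])]; rfl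
    have a2 : (∀ j : Fin (N + 1), x j = decide ((i : ℕ) ≤ (j : ℕ))) ↔
        (∀ j ∈ univ.erase i, x j = decide (i < j)) ∧ x i = true := by
      constructor
      · intro h
        refine ⟨fun j hj => ?_, ?_⟩
        · rw [h j]
          simp only [mem_erase, mem_univ, and_true] at hj
          have : (i : ℕ) ≠ j := fun h => hj (Fin.ext h.symm)
          rw [decide_eq_decide, Fin.lt_def]
          omega
        · rw [h i]; simp
      · rintro ⟨h, hi⟩ j
        by_cases hj : j = i
        · subst hj; rw [hi]; simp
        · rw [h j (by simp [hj])]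
          have : (i : ℕ) ≠ j := fun h => hj (Fin.ext h.symm)
          rw [decide_eq_decide, Fin.lt_def]
          omega
    simp only [a1, a2]
    by_cases hq : (∀ j ∈ univ.erase i, x j = decide (i < j))
    · cases hxi : x i <;> simp [hq]
    · simp only [if_neg hq, hq, false_and, if_false, add_zero]
  rw [Finset.sum_congr rfl (fun i _ => key i),
    Fin.sum_univ_eq_sum_range (fun k => A (k + 1) - A k) (N + 1), Finset.sum_range_sub]
  have hA1 : A (N + 1) = 0 := by
    simp only [A]
    rw [if_neg]
    intro h
    apply h0
    intro j
    rw [h j]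
    have := j.2
    simp only [decide_eq_false_iff_not]
    omega
  have hA0 : A 0 = 0 := by
    simp only [A]
    rw [if_neg]
    intro h
    apply h1
    intro j
    rw [h j]
    simp
  rw [hA1, hA0, sub_zero]

lemma core (N : ℕ) (π : Fin (N + 1) → ℕ → Fin N × Bool)
    (hfull : ∀ i a, ∃ k, π i k = a) :
    ∃ f : ℕ → (Fin (N + 1) → ℕ), ∀ t, St π (f t) (f (t + 1)) := by
  classical
  by_contra hcon
  have hwf : WellFounded (fun c' c => St π c c') := by
    rw [wellFounded_iff_isEmpty_descending_chain]
    refine ⟨fun f => hcon ⟨f.1, f.2⟩⟩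
  let h : Fin (N + 1) → (Fin (N + 1) → ℕ) → ZMod 2 := fun i c =>
    if ∀ j ∈ univ.erase i, (π j (c j)).2 = decide (i < j) then 1 else 0
  have hh : ∀ i c d, (∀ j ∈ univ.erase i, c j = d j) → h i c = h i d := by
    intro i c d hcd
    simp only [h]
    congr 1
    apply propext
    apply forall₂_congr
    intro j hj
    rw [hcd j hj]
  choose H H1 H2 H3 using fun i => exists_H π hwf (univ.erase i) (h i) (hh i)
  have zero : ∀ c, ∑ i, H i c = 0 := by
    intro c
    induction c using hwf.induction with
    | _ c ih =>
      by_cases hc : term (ch π c) univ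
      · have : ∀ i, H i c = h i c := by
          intro i
          apply H2
          intro a _ b _
          exact hc a (mem_univ _) b (mem_univ _)
        simp only [this, h]
        have nm : ∀ b : Bool, ¬ ∀ j, (π j (c j)).2 = b := by
          intro b hb
          have inj : Function.Injective (fun j => (π j (c j)).1) := by
            intro j k hjk
            exact hc j (mem_univ _) k (mem_univ _) (Prod.ext hjk ((hb j).trans (hb k).symm))
          have := Fintype.card_le_of_injective _ inj
          simp at this
        exact mono_sum N (fun j => (π j (c j)).2) (nm false) (nm true)
      · have : ∀ i, H i c = ∑ S : Finset (Fin (N + 1)), wt (ch π c) univ S * H i (mv c S) := by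
          intro i
          rw [marg_sum π i (H i) (H1 i) c]
          exact H3 i c
        rw [Finset.sum_congr rfl (fun i _ => this i), Finset.sum_comm]
        apply Finset.sum_eq_zero
        intro S _
        rw [← Finset.mul_sum]
        by_cases hw : wt (ch π c) univ S = 0
        · rw [hw, zero_mul]
        · have hne : S ≠ ∅ := by
            rintro rfl
            exact hw (wt_empty_nonterm _ _ hc)
          rw [ih _ (st_of_wt π c univ S (subset_univ _) hw hne), mul_zero]
  choose p hp using hfull
  let cfg : (Fin N → Bool) → (Fin (N + 1) → ℕ) := fun ε =>
    Fin.snoc (α := fun _ => ℕ) (fun i : Fin N => p i.castSucc (i, ε i)) 0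
  have cfg_cs : ∀ ε (i : Fin N), π i.castSucc (cfg ε i.castSucc) = (i, ε i) := by
    intro ε i
    simp only [cfg, Fin.snoc_castSucc, hp]
  have tot : ∑ ε : Fin N → Bool, ∑ i, H i (cfg ε) = 0 := by
    simp only [zero, Finset.sum_const_zero]
  rw [Finset.sum_comm, Fin.sum_univ_castSucc] at tot
  have z1 : ∀ i : Fin N, ∑ ε : Fin N → Bool, H i.castSucc (cfg ε) = 0 := by
    intro i
    apply Finset.sum_involution (fun ε _ => Function.update ε i (!(ε i)))
    · intro ε _
      rw [H1 i.castSucc (cfg (Function.update ε i (!(ε i)))) (cfg ε)]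
      · exact CharTwo.add_self_eq_zero _
      · intro j hj
        simp only [mem_erase, mem_univ, and_true] at hj
        induction j using Fin.lastCases with
        | last => simp [cfg]
        | cast j =>
          have hji : j ≠ i := fun h => hj (by rw [h])
          simp [cfg, hji]
    · intro ε _ _ heq
      have := congrFun heq i
      simp at this
    · intro ε _
      simp
    · intro ε _
      simp
  have z2 : ∀ ε, H (Fin.last N) (cfg ε) = if ε = (fun _ => false) then 1 else 0 := by
    intro ε
    rw [H2]
    · simp only [h]
      congr 1
      apply propext
      constructor
      · intro hx
        funext j
        have := hx j.castSucc (by simp [Fin.ext_iff, j.2.ne])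
        rw [cfg_cs] at this
        have hlt : ¬ (Fin.last N < j.castSucc) := not_lt.mpr (Fin.le_last _)
        simpa [hlt] using this
      · rintro rfl j hj
        simp only [mem_erase, mem_univ, and_true] at hj
        induction j using Fin.lastCases with
        | last => exact absurd rfl hj
        | cast j =>
          have hlt : ¬ (Fin.last N < j.castSucc) := not_lt.mpr (Fin.le_last _)
          rw [cfg_cs]
          simp [hlt]
    · intro i hi j hj hx
      simp only [mem_erase, mem_univ, and_true] at hi hj
      induction i using Fin.lastCases with
      | last => exact absurd rfl hi
      | cast i =>
        induction j using Fin.lastCases with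
        | last => exact absurd rfl hj
        | cast j =>
          simp only [ch, cfg_cs] at hx
          have hij : i = j := (Prod.ext_iff.mp hx).1
          rw [hij]
  simp only [z1, z2, Finset.sum_const_zero, zero_add] at tot
  simp at tot

end MC

theorem stmt_1 (n m : ℕ) (hn : 2 ≤ n) (hm1 : 1 ≤ m) (hm2 : m ≤ 2 * n - 2)
    (π : Fin n → ℕ → Fin m) (hfull : ∀ i, ∀ a : Fin m, ∃ k, π i k = a) :
    ∃ f : ℕ → (Fin n → ℕ), ∀ t, IStep π (f t) (f (t + 1)) := by
  classical
  obtain ⟨N, rfl⟩ : ∃ N, n = N + 1 := ⟨n - 1, by omega⟩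
  have hcard : Fintype.card (Fin N × Bool) = N * 2 := by simp
  let d := Fintype.card (Fin N × Bool)
  let E : Fin N × Bool ≃ Fin d := Fintype.equivFin _
  obtain ⟨e⟩ : Nonempty (Fin m ↪ Fin N × Bool) := by
    apply Function.Embedding.nonempty_of_card_le
    rw [hcard, Fintype.card_fin]
    omega
  haveI : Nonempty (Fin m) := ⟨⟨0, hm1⟩⟩
  let r : Fin N × Bool → Fin m := Function.invFun e
  have hr : ∀ a, r (e a) = a := Function.leftInverse_invFun e.injective
  let π' : Fin (N + 1) → ℕ → Fin N × Bool := fun i k =>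
    if hk : k < d then E.symm ⟨k, hk⟩ else e (π i (k - d))
  obtain ⟨f, hf⟩ := MC.core N π' (by
    intro i a
    refine ⟨E a, ?_⟩
    simp [π'])
  have mono : ∀ i, Monotone (fun t => f t i) := by
    intro i
    apply monotone_nat_of_le_succ
    intro t
    obtain ⟨S, _, _, h⟩ := hf t
    simp only [h, MC.mv]
    split_ifs <;> omega
  have ev : ∀ i, ∃ T, ∀ t ≥ T, (d ≤ f t i ∧ d ≤ f T i) ∨ (f t i = f T i ∧ f T i < d) := by
    intro i
    by_cases hb : ∃ T, d ≤ f T i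
    · obtain ⟨T, hT⟩ := hb
      exact ⟨T, fun t ht => Or.inl ⟨hT.trans (mono i ht), hT⟩⟩
    · push Not at hb
      obtain ⟨T, hT⟩ : ∃ T, ∀ t, f t i ≤ f T i := by
        have hfin : (Set.range (fun t => f t i)).Finite :=
          (Set.finite_lt_nat d).subset (by rintro _ ⟨t, rfl⟩; exact hb t)
        obtain ⟨x, ⟨T, hT⟩, hx⟩ := Set.exists_max_image _ id hfin ⟨_, ⟨0, rfl⟩⟩
        refine ⟨T, fun t => ?_⟩
        have := hx (f t i) ⟨t, rfl⟩
        simp only [id] at this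
        simp only at hT
        omega
      exact ⟨T, fun t ht => Or.inr ⟨le_antisymm (hT t) (mono i ht), hb T⟩⟩
  choose T0 hT0 using ev
  let T := Finset.univ.sup T0
  have hT : ∀ i, (∀ t, d ≤ f (T + t) i) ∨ (∀ t, f (T + t) i = f T i ∧ f T i < d) := by
    intro i
    have hle : T0 i ≤ T := Finset.le_sup (Finset.mem_univ i)
    rcases hT0 i T hle with h | h
    · left
      intro t
      exact h.1.trans (mono i (by omega))
    · right
      intro t
      rcases hT0 i (T + t) (by omega) with h' | h'
      · omega
      · omega
  choose q hq using hfull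
  let g : ℕ → Fin (N + 1) → ℕ := fun t i =>
    if d ≤ f T i then f (T + t) i - d else q i (r (π' i (f T i)))
  have hg : ∀ t i, π i (g t i) = r (π' i (f (T + t) i)) := by
    intro t i
    rcases hT i with h | h
    · have h0 := h 0
      have ht := h t
      rw [add_zero] at h0
      simp only [g, if_pos h0, π']
      rw [dif_neg (by omega), hr]
    · have ht := h t
      simp only [g]
      rw [if_neg (by omega), hq, ht.1]
  refine ⟨g, fun t => ?_⟩
  obtain ⟨S, hS, hc, hmv⟩ := hf (T + t)
  have hval : ∀ i, f (T + (t + 1)) i = if i ∈ S then f (T + t) i + 1 else f (T + t) i := by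
    intro i
    rw [← add_assoc, hmv]
    rfl
  refine ⟨S, hS, ?_, ?_, ?_⟩
  · intro i hi
    obtain ⟨j, hj, hx⟩ := hc i hi
    exact ⟨j, hj, by rw [hg, hg, hx]⟩
  · intro i hi
    have hv := hval i
    rw [if_pos hi] at hv
    rcases hT i with h | h
    · have h0 := h 0
      have ht := h t
      rw [add_zero] at h0
      simp only [g, if_pos h0]
      omega
    · have h1 := h t
      have h2 := h (t + 1)
      omega
  · intro i hi
    have hv := hval i
    rw [if_neg hi] at hv
    simp only [g, hv]
end

section
/- Let n ≥ 2 and let π_1,…,π_N be any N = 2n−1 infinite words over the alphabet {1,…,2n−2} (no fullness assumed). Then there is a choice of n of these words and an initial configuration from which there is an infinite run of immediate-scheduler steps; i.e., the scheduler wins against some n of the 2n−1 words. -/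
/-- A step of the immediate scheduler in the subgame played by the players of `S`:
a nonempty set `T ⊆ S` of players, each in conflict with another player of `S`,
has its positions increased by one; all other players stay put. -/
def SubStep {N m : ℕ} (π : Fin N → ℕ → Fin m) (S : Finset (Fin N))
    (c c' : Fin N → ℕ) : Prop :=
  ∃ T : Finset (Fin N), T ⊆ S ∧ T.Nonempty ∧
    (∀ i ∈ T, ∃ j ∈ S, j ≠ i ∧ π j (c j) = π i (c i)) ∧
    (∀ i ∈ T, c' i = c i + 1) ∧
    (∀ i ∉ T, c' i = c i)

set_option linter.unusedSectionVars false

namespace MC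

section Boolean

variable {α : Type*} [Fintype α] [DecidableEq α]

/-- The sum of all partial derivatives on multilinear polynomials, seen as functions on finsets. -/
def D : (Finset α → ℚ) →ₗ[ℚ] (Finset α → ℚ) where
  toFun f := fun T => ∑ x ∈ Tᶜ, f (insert x T)
  map_add' f g := by
    funext T
    simp [Finset.sum_add_distrib]
  map_smul' r f := by
    funext T
    simp [Finset.mul_sum]

theorem D_apply (f : Finset α → ℚ) (T : Finset α) : D f T = ∑ x ∈ Tᶜ, f (insert x T) := rfl

/-- Multiplication by the variable `a`. -/
def M (a : α) : (Finset α → ℚ) →ₗ[ℚ] (Finset α → ℚ) where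
  toFun f := fun T => if a ∈ T then f (T.erase a) else 0
  map_add' f g := by
    funext T
    by_cases h : a ∈ T <;> simp [h]
  map_smul' r f := by
    funext T
    by_cases h : a ∈ T <;> simp [h]

theorem M_apply (a : α) (f : Finset α → ℚ) (T : Finset α) :
    M a f T = if a ∈ T then f (T.erase a) else 0 := rfl

/-- `f` does not involve the variable `a`. -/
def Free (a : α) (f : Finset α → ℚ) : Prop := ∀ T, a ∈ T → f T = 0

theorem Free.D {a : α} {f : Finset α → ℚ} (h : Free a f) : Free a (D f) := by
  intro T hT
  rw [D_apply]
  exact Finset.sum_eq_zero fun x _ => h _ (Finset.mem_insert_of_mem hT)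

theorem Free.D_pow {a : α} {f : Finset α → ℚ} (h : Free a f) (j : ℕ) :
    Free a ((MC.D ^ j) f) := by
  induction j with
  | zero => simpa using h
  | succ j ih => rw [pow_succ']; exact ih.D

theorem D_M {a : α} {g : Finset α → ℚ} (h : Free a g) : D (M a g) = M a (D g) + g := by
  funext T
  rw [Pi.add_apply, D_apply, M_apply]
  by_cases ha : a ∈ T
  · rw [if_pos ha, h T ha, add_zero, D_apply]
    have hc : (T.erase a)ᶜ = insert a Tᶜ := by
      ext x; simp only [Finset.mem_compl, Finset.mem_erase, Finset.mem_insert]; tauto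
    rw [hc, Finset.sum_insert (by simpa using ha),
      h (insert a (T.erase a)) (Finset.mem_insert_self _ _), zero_add]
    refine Finset.sum_congr rfl fun x hx => ?_
    have hxT : x ∉ T := by simpa using hx
    have hxa : x ≠ a := fun e => hxT (e ▸ ha)
    rw [M_apply, if_pos (Finset.mem_insert_of_mem ha), Finset.erase_insert_of_ne hxa]
  · rw [if_neg ha, zero_add, Finset.sum_eq_single a]
    · rw [M_apply, if_pos (Finset.mem_insert_self _ _), Finset.erase_insert ha]
    · intro x _ hx
      rw [M_apply, if_neg]
      simp only [Finset.mem_insert, not_or]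
      exact ⟨fun e => hx e.symm, ha⟩
    · intro h'
      simp [ha] at h'

theorem D_pow_M {a : α} {g : Finset α → ℚ} (h : Free a g) (j : ℕ) :
    (D ^ (j + 1)) (M a g) = M a ((D ^ (j + 1)) g) + ((j : ℚ) + 1) • (D ^ j) g := by
  induction j with
  | zero => simpa using D_M h
  | succ j ih =>
    have e1 : ∀ i, D ((D ^ i) g) = (D ^ (i + 1)) g := fun i => by
      rw [pow_succ', Module.End.mul_apply]
    have e2 : (D ^ (j + 1 + 1)) (M a g) = D ((D ^ (j + 1)) (M a g)) := by
      rw [pow_succ', Module.End.mul_apply]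
    rw [e2, ih, map_add, D_M (h.D_pow _), map_smul, e1, e1]
    push_cast
    module

theorem inj (A : Finset α) : ∀ (j k : ℕ) (f : Finset α → ℚ),
    (∀ T, f T ≠ 0 → T ⊆ A ∧ T.card = k) → A.card + j ≤ 2 * k → (D ^ j) f = 0 → f = 0 := by
  induction A using Finset.induction_on with
  | empty =>
    intro j k f hf hk hD
    rcases Nat.eq_zero_or_pos j with rfl | hj
    · simpa using hD
    · funext T
      by_contra hT
      obtain ⟨h1, h2⟩ := hf T hT
      rw [Finset.subset_empty] at h1
      subst h1
      simp at h2
      omega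
  | insert a A ha ih =>
    intro j k f hf hk hD
    rcases Nat.eq_zero_or_pos j with rfl | hj
    · simpa using hD
    obtain ⟨i, rfl⟩ : ∃ i, j = i + 1 := ⟨j - 1, by omega⟩
    rw [Finset.card_insert_of_notMem ha] at hk
    set g : Finset α → ℚ := fun T => if a ∈ T then 0 else f (insert a T) with hg
    set h : Finset α → ℚ := fun T => if a ∈ T then 0 else f T with hh
    have gF : Free a g := fun T hT => by simp [hg, hT]
    have hF : Free a h := fun T hT => by simp [hh, hT]
    have hfe : f = h + M a g := by
      funext T
      rw [Pi.add_apply, M_apply]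
      by_cases hT : a ∈ T
      · simp [hh, hg, hT, Finset.insert_erase]
      · simp [hh, hT]
    rw [hfe, map_add, D_pow_M gF] at hD
    have e1 : (D ^ (i + 1)) g = 0 := by
      funext T
      by_cases hT : a ∈ T
      · exact gF.D_pow _ T hT
      · have := congrFun hD (insert a T)
        have z1 := hF.D_pow (i + 1) (insert a T) (Finset.mem_insert_self _ _)
        have z2 := gF.D_pow i (insert a T) (Finset.mem_insert_self _ _)
        simpa [z1, z2, M_apply, Finset.erase_insert hT] using this
    rw [e1, map_zero, zero_add] at hD
    have h0 : h = 0 := by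
      apply ih (i + 1 + 1) k h
      · intro T hT
        have haT : a ∉ T := fun q => hT (hF T q)
        have : f T ≠ 0 := by simpa [hh, haT] using hT
        obtain ⟨h1, h2⟩ := hf T this
        exact ⟨(Finset.subset_insert_iff_of_notMem haT).1 h1, h2⟩
      · omega
      · have := congrArg D hD
        rw [map_add, map_smul, ← Module.End.mul_apply, ← pow_succ', ← Module.End.mul_apply,
          ← pow_succ', e1, smul_zero, add_zero, map_zero] at this
        exact this
    rw [h0, map_zero, zero_add] at hD
    have hne : ((i : ℚ) + 1) ≠ 0 := by positivity
    have e2 : (D ^ i) g = 0 := by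
      rcases smul_eq_zero.1 hD with q | q
      · exact absurd q hne
      · exact q
    have g0 : g = 0 := by
      by_contra hgne
      obtain ⟨T0, hT0⟩ := Function.ne_iff.1 hgne
      have key : ∀ T, g T ≠ 0 → T ⊆ A ∧ T.card + 1 = k := by
        intro T hT
        have haT : a ∉ T := fun q => hT (gF T q)
        have : f (insert a T) ≠ 0 := by simpa [hg, haT] using hT
        obtain ⟨h1, h2⟩ := hf _ this
        rw [Finset.card_insert_of_notMem haT] at h2
        exact ⟨(Finset.insert_subset_insert_iff haT).1 h1, h2⟩
      have k1 := (key T0 hT0).2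
      exact hgne (ih i (k - 1) g (fun T hT => ⟨(key T hT).1, by have := (key T hT).2; omega⟩)
        (by omega) e2)
    rw [hfe, h0, g0, map_zero, add_zero]

/-- Monomials. -/
def mono (T0 : Finset α) : Finset α → ℚ := fun T => if T = T0 then 1 else 0

theorem D_mono (T0 : Finset α) : D (mono T0) = ∑ x ∈ T0, mono (T0.erase x) := by
  funext T
  rw [D_apply, Finset.sum_apply]
  have h1 : ∀ x, x ∈ Tᶜ ∧ insert x T = T0 ↔ x ∈ T0 ∧ T = T0.erase x := by
    intro x
    rw [Finset.mem_compl]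
    constructor
    · rintro ⟨hx, rfl⟩
      exact ⟨Finset.mem_insert_self _ _, (Finset.erase_insert hx).symm⟩
    · rintro ⟨hx, rfl⟩
      exact ⟨Finset.notMem_erase _ _, Finset.insert_erase hx⟩
  simp only [mono]
  rw [← Finset.sum_filter, ← Finset.sum_filter]
  congr 1
  ext x
  simp only [Finset.mem_filter]
  exact h1 x

/-! ### Signed products of pairs -/

variable {ρ : Type*} [DecidableEq ρ]

def G (P : Finset ρ → Finset α → ℚ) : List (ρ × ρ) → Finset ρ → Finset α → ℚ
  | [], σ => P σ
  | (u, v) :: L, σ => G P L (insert u σ) - G P L (insert v σ)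

def Good : List (ρ × ρ) → Finset ρ → Prop
  | [], _ => True
  | (u, v) :: L, E => u ∈ E ∧ v ∈ E ∧ u ≠ v ∧ Good L ((E.erase u).erase v)

theorem exists_good (r : ℕ) : ∀ E : Finset ρ, E.card = 2 * r →
    ∃ L : List (ρ × ρ), L.length = r ∧ Good L E := by
  induction r with
  | zero => intro E _; exact ⟨[], rfl, trivial⟩
  | succ r ih =>
    intro E hE
    obtain ⟨u, hu, v, hv, huv⟩ := Finset.one_lt_card.1 (show 1 < E.card by omega)
    have hv' : v ∈ E.erase u := Finset.mem_erase.2 ⟨huv.symm, hv⟩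
    obtain ⟨L, hL, hG⟩ := ih ((E.erase u).erase v) (by
      rw [Finset.card_erase_of_mem hv', Finset.card_erase_of_mem hu]; omega)
    exact ⟨(u, v) :: L, by simp [hL], hu, hv, huv, hG⟩

theorem disj_step {E σ : Finset ρ} {u v x : ρ} (h : Disjoint σ E) (hx : x = u ∨ x = v) :
    Disjoint (insert x σ) ((E.erase u).erase v) := by
  rw [Finset.disjoint_left] at *
  intro a ha hE
  simp only [Finset.mem_insert, Finset.mem_erase] at ha hE
  rcases ha with rfl | ha
  · tauto
  · exact h ha hE.2.2

theorem D_G (P : Finset ρ → Finset α → ℚ) (n : ℕ)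
    (hP : ∀ σ : Finset ρ, σ.card ≤ n → D (P σ) = ∑ w ∈ σ, P (σ.erase w)) :
    ∀ (L : List (ρ × ρ)) (E σ : Finset ρ), Good L E → Disjoint σ E → σ.card + L.length ≤ n →
      D (G P L σ) = ∑ w ∈ σ, G P L (σ.erase w) := by
  intro L
  induction L with
  | nil => intro E σ _ _ hc; exact hP σ (by simpa using hc)
  | cons p L ih =>
    obtain ⟨u, v⟩ := p
    intro E σ hG hd hc
    obtain ⟨hu, hv, huv, hG'⟩ := hG
    have huσ : u ∉ σ := fun h => Finset.disjoint_left.1 hd h hu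
    have hvσ : v ∉ σ := fun h => Finset.disjoint_left.1 hd h hv
    rw [List.length_cons] at hc
    simp only [G]
    rw [map_sub, ih _ (insert u σ) hG' (disj_step hd (Or.inl rfl))
        (by rw [Finset.card_insert_of_notMem huσ]; omega),
      ih _ (insert v σ) hG' (disj_step hd (Or.inr rfl))
        (by rw [Finset.card_insert_of_notMem hvσ]; omega),
      Finset.sum_insert huσ, Finset.sum_insert hvσ, Finset.erase_insert huσ,
      Finset.erase_insert hvσ, add_sub_add_left_eq_sub, ← Finset.sum_sub_distrib]
    refine Finset.sum_congr rfl fun w hw => ?_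
    rw [Finset.erase_insert_of_ne (fun e : u = w => huσ (e ▸ hw)),
      Finset.erase_insert_of_ne (fun e : v = w => hvσ (e ▸ hw))]

theorem D_pow_G (P : Finset ρ → Finset α → ℚ) (n : ℕ)
    (hP : ∀ σ : Finset ρ, σ.card ≤ n → D (P σ) = ∑ w ∈ σ, P (σ.erase w))
    (L : List (ρ × ρ)) (E : Finset ρ) (hG : Good L E) (k : ℕ) :
    ∀ σ : Finset ρ, σ.card = k → Disjoint σ E → σ.card + L.length ≤ n →
      (D ^ k) (G P L σ) = (k.factorial : ℚ) • G P L ∅ := by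
  induction k with
  | zero =>
    intro σ hσ _ _
    rw [Finset.card_eq_zero] at hσ
    simp [hσ]
  | succ k ih =>
    intro σ hσ hd hc
    rw [pow_succ, Module.End.mul_apply, D_G P n hP L E σ hG hd hc, map_sum]
    rw [Finset.sum_congr rfl (fun w hw => ih (σ.erase w)
      (by rw [Finset.card_erase_of_mem hw]; omega)
      (hd.mono_left (Finset.erase_subset _ _))
      (by rw [Finset.card_erase_of_mem hw]; omega))]
    rw [Finset.sum_const, hσ, Nat.factorial_succ, ← Nat.cast_smul_eq_nsmul ℚ, smul_smul]
    push_cast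
    rfl

theorem G_supp (P : Finset ρ → Finset α → ℚ) (n : ℕ) (A : Finset α) (U : Finset ρ)
    (hP : ∀ σ : Finset ρ, σ ⊆ U → σ.card ≤ n → ∀ T, P σ T ≠ 0 → T ⊆ A ∧ T.card = σ.card) :
    ∀ (L : List (ρ × ρ)) (E σ : Finset ρ), Good L E → Disjoint σ E → σ.card + L.length ≤ n →
      σ ⊆ U → E ⊆ U → ∀ T, G P L σ T ≠ 0 → T ⊆ A ∧ T.card = σ.card + L.length := by
  intro L
  induction L with
  | nil => intro E σ _ _ hc hσ _ T hT; exact hP σ hσ (by simpa using hc) T hT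
  | cons p L ih =>
    obtain ⟨u, v⟩ := p
    intro E σ hG hd hc hσ hE T hT
    obtain ⟨hu, hv, huv, hG'⟩ := hG
    have huσ : u ∉ σ := fun h => Finset.disjoint_left.1 hd h hu
    have hvσ : v ∉ σ := fun h => Finset.disjoint_left.1 hd h hv
    rw [List.length_cons] at hc ⊢
    have hE' : (E.erase u).erase v ⊆ U :=
      ((Finset.erase_subset _ _).trans (Finset.erase_subset _ _)).trans hE
    have cu := Finset.card_insert_of_notMem huσ
    have cv := Finset.card_insert_of_notMem hvσ
    simp only [G, Pi.sub_apply] at hT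
    by_cases h1 : G P L (insert u σ) T = 0
    · have h2 : G P L (insert v σ) T ≠ 0 := fun h2 => hT (by rw [h1, h2, sub_zero])
      have := ih _ (insert v σ) hG' (disj_step hd (Or.inr rfl)) (by omega)
        (Finset.insert_subset (hE hv) hσ) hE' T h2
      exact ⟨this.1, by omega⟩
    · have := ih _ (insert u σ) hG' (disj_step hd (Or.inl rfl)) (by omega)
        (Finset.insert_subset (hE hu) hσ) hE' T h1
      exact ⟨this.1, by omega⟩

theorem G_sub (P : Finset ρ → Finset α → ℚ) (n : ℕ) (X : Finset ρ) (c : ρ → α)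
    (hP : ∀ σ : Finset ρ, σ ⊆ X → σ.card ≤ n → P σ = mono (σ.image c)) :
    ∀ (L : List (ρ × ρ)) (E σ : Finset ρ), Good L E → σ.card + L.length ≤ n →
      σ ⊆ X → E ⊆ X → ∀ T, G P L σ T ≠ 0 → σ.image c ⊆ T := by
  intro L
  induction L with
  | nil =>
    intro E σ _ hc hσ _ T hT
    simp only [G] at hT
    rw [hP σ hσ (by simpa using hc), mono] at hT
    by_cases h : T = σ.image c
    · rw [h]
    · simp [h] at hT
  | cons p L ih =>
    obtain ⟨u, v⟩ := p
    intro E σ hG hc hσ hE T hT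
    obtain ⟨hu, hv, huv, hG'⟩ := hG
    rw [List.length_cons] at hc
    have hE' : (E.erase u).erase v ⊆ X :=
      ((Finset.erase_subset _ _).trans (Finset.erase_subset _ _)).trans hE
    have cu := Finset.card_insert_le u σ
    have cv := Finset.card_insert_le v σ
    simp only [G, Pi.sub_apply] at hT
    by_cases h1 : G P L (insert u σ) T = 0
    · have h2 : G P L (insert v σ) T ≠ 0 := fun h2 => hT (by rw [h1, h2, sub_zero])
      exact (Finset.image_subset_image (Finset.subset_insert _ _)).trans
        (ih _ (insert v σ) hG' (by omega) (Finset.insert_subset (hE hv) hσ) hE' T h2)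
    · exact (Finset.image_subset_image (Finset.subset_insert _ _)).trans
        (ih _ (insert u σ) hG' (by omega) (Finset.insert_subset (hE hu) hσ) hE' T h1)

theorem G_ne (P : Finset ρ → Finset α → ℚ) (n : ℕ) (X : Finset ρ) (c : ρ → α)
    (hc : Set.InjOn c X)
    (hP : ∀ σ : Finset ρ, σ ⊆ X → σ.card ≤ n → P σ = mono (σ.image c)) :
    ∀ (L : List (ρ × ρ)) (E σ : Finset ρ), Good L E → Disjoint σ E → σ.card + L.length ≤ n →
      σ ⊆ X → E ⊆ X → ∃ Y : Finset ρ, Y ⊆ σ ∪ E ∧ G P L σ (Y.image c) = 1 := by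
  intro L
  induction L with
  | nil =>
    intro E σ _ _ hn hσ _
    refine ⟨σ, Finset.subset_union_left, ?_⟩
    simp only [G]
    rw [hP σ hσ (by simpa using hn)]
    simp [mono]
  | cons p L ih =>
    obtain ⟨u, v⟩ := p
    intro E σ hG hd hn hσ hE
    obtain ⟨hu, hv, huv, hG'⟩ := hG
    have hvσ : v ∉ σ := fun h => Finset.disjoint_left.1 hd h hv
    rw [List.length_cons] at hn
    have hE' : (E.erase u).erase v ⊆ X :=
      ((Finset.erase_subset _ _).trans (Finset.erase_subset _ _)).trans hE
    have cu := Finset.card_insert_le u σ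
    have cv := Finset.card_insert_le v σ
    obtain ⟨Y, hY, hY1⟩ := ih _ (insert u σ) hG' (disj_step hd (Or.inl rfl)) (by omega)
      (Finset.insert_subset (hE hu) hσ) hE'
    have hvY : v ∉ Y := by
      intro h
      have := hY h
      simp only [Finset.mem_union, Finset.mem_insert, Finset.mem_erase] at this
      rcases this with (h | h) | h
      · exact huv h.symm
      · exact hvσ h
      · exact h.1 rfl
    have hYX : Y ⊆ X := by
      refine hY.trans (Finset.union_subset (Finset.insert_subset (hE hu) hσ) hE')
    refine ⟨Y, ?_, ?_⟩
    · intro y hy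
      have := hY hy
      simp only [Finset.mem_union, Finset.mem_insert, Finset.mem_erase] at this ⊢
      rcases this with (h | h) | h
      · exact Or.inr (h ▸ hu)
      · exact Or.inl h
      · exact Or.inr h.2.2
    · simp only [G, Pi.sub_apply]
      rw [hY1]
      have : G P L (insert v σ) (Y.image c) = 0 := by
        by_contra hne
        have := G_sub P n X c hP L _ (insert v σ) hG' (by omega)
          (Finset.insert_subset (hE hv) hσ) hE' _ hne
        have hcv := this (Finset.mem_image_of_mem c (Finset.mem_insert_self v σ))
        obtain ⟨y, hy, hyv⟩ := Finset.mem_image.1 hcv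
        exact hvY (hc (hYX hy) (hE hv) hyv ▸ hy)
      rw [this, sub_zero]

/-- The algebraic contradiction. -/
theorem no_P (P : Finset ρ → Finset α → ℚ) (n : ℕ) (A : Finset α) (U X : Finset ρ) (c : ρ → α)
    (hXU : X ⊆ U) (hXA : X.card = A.card) (hUA : U.card = A.card + 1)
    (hA : A.card + 2 ≤ 2 * n)
    (hc : Set.InjOn c X)
    (h1 : ∀ σ : Finset ρ, σ ⊆ X → σ.card ≤ n → P σ = mono (σ.image c))
    (h2 : ∀ σ : Finset ρ, σ ⊆ U → σ.card ≤ n → ∀ T, P σ T ≠ 0 → T ⊆ A ∧ T.card = σ.card)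
    (h3 : ∀ σ : Finset ρ, σ.card ≤ n → D (P σ) = ∑ w ∈ σ, P (σ.erase w)) : False := by
  obtain ⟨E, hEX, hE⟩ := Finset.exists_subset_card_eq (s := X) (n := 2 * (A.card / 2)) (by omega)
  obtain ⟨L, hL, hG⟩ := exists_good (A.card / 2) E hE
  have hEU := hEX.trans hXU
  have hW : (U \ E).card = A.card + 1 - 2 * (A.card / 2) := by
    rw [Finset.card_sdiff_of_subset hEU, hUA, hE]
  have hd : Disjoint (U \ E) E := Finset.sdiff_disjoint
  have hlen : (U \ E).card + L.length ≤ n := by omega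
  have hk := D_pow_G P n h3 L E hG _ (U \ E) rfl hd hlen
  have h0 : D (G P L ∅) = 0 := by
    rw [D_G P n h3 L E ∅ hG (Finset.disjoint_empty_left _) (by simp; omega)]
    simp
  have hz : G P L (U \ E) = 0 := by
    apply inj A ((U \ E).card + 1) ((U \ E).card + L.length)
    · exact G_supp P n A U h2 L E (U \ E) hG hd hlen Finset.sdiff_subset hEU
    · omega
    · rw [pow_succ', Module.End.mul_apply, hk, map_smul, h0, smul_zero]
  rw [hz, map_zero] at hk
  obtain ⟨Y, _, hY⟩ := G_ne P n X c hc h1 L E ∅ hG (Finset.disjoint_empty_left _)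
    (by simp; omega) (Finset.empty_subset _) hEX
  have := congrFun hk (Y.image c)
  rw [Pi.smul_apply, hY] at this
  have hpos : ((U \ E).card.factorial : ℚ) ≠ 0 := Nat.cast_ne_zero.2 (Nat.factorial_ne_zero _)
  apply hpos
  simpa using this.symm

end Boolean

section Game

variable {N m : ℕ} (π : Fin N → ℕ → Fin m)

/-- Advance player `i`. -/
def up (i : Fin N) (c : Fin N → ℕ) : Fin N → ℕ := Function.update c i (c i + 1)

theorem up_self (i : Fin N) (c : Fin N → ℕ) : up i c i = c i + 1 := by simp [up]

theorem up_ne {i k : Fin N} (h : k ≠ i) (c : Fin N → ℕ) : up i c k = c k := by simp [up, h]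

theorem up_comm (i j : Fin N) (c : Fin N → ℕ) : up i (up j c) = up j (up i c) := by
  rcases eq_or_ne i j with rfl | h
  · rfl
  · funext k
    by_cases h1 : k = i
    · subst h1; rw [up_self, up_ne h, up_ne h, up_self]
    · by_cases h2 : k = j
      · subst h2; rw [up_ne h1, up_self, up_self, up_ne h1]
      · rw [up_ne h1, up_ne h2, up_ne h2, up_ne h1]

/-- Players `i`, `j` of `σ` are in conflict. -/
def Conf (σ : Finset (Fin N)) (c : Fin N → ℕ) (i j : Fin N) : Prop :=
  i ∈ σ ∧ j ∈ σ ∧ i ≠ j ∧ π i (c i) = π j (c j)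

variable {π}

theorem Conf.symm {σ : Finset (Fin N)} {c : Fin N → ℕ} {i j : Fin N} (h : Conf π σ c i j) :
    Conf π σ c j i := ⟨h.2.1, h.1, h.2.2.1.symm, h.2.2.2.symm⟩

theorem Conf.step1 {σ : Finset (Fin N)} {c : Fin N → ℕ} {i j : Fin N} (h : Conf π σ c i j) :
    SubStep π σ c (up i c) := by
  refine ⟨{i}, by simpa using h.1, by simp, ?_, ?_, ?_⟩
  · intro k hk
    rw [Finset.mem_singleton] at hk
    subst hk
    exact ⟨j, h.2.1, h.2.2.1.symm, h.2.2.2.symm⟩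
  · intro k hk
    rw [Finset.mem_singleton] at hk
    subst hk
    exact up_self _ _
  · intro k hk
    rw [Finset.mem_singleton] at hk
    exact up_ne hk _

theorem Conf.step2 {σ : Finset (Fin N)} {c : Fin N → ℕ} {i j : Fin N} (h : Conf π σ c i j) :
    SubStep π σ c (up i (up j c)) := by
  refine ⟨{i, j}, ?_, by simp, ?_, ?_, ?_⟩
  · intro k hk
    simp only [Finset.mem_insert, Finset.mem_singleton] at hk
    rcases hk with rfl | rfl
    · exact h.1
    · exact h.2.1
  · intro k hk
    simp only [Finset.mem_insert, Finset.mem_singleton] at hk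
    rcases hk with rfl | rfl
    · exact ⟨j, h.2.1, h.2.2.1.symm, h.2.2.2.symm⟩
    · exact ⟨i, h.1, h.2.2.1, h.2.2.2⟩
  · intro k hk
    simp only [Finset.mem_insert, Finset.mem_singleton] at hk
    rcases hk with rfl | rfl
    · rw [up_self, up_ne h.2.2.1]
    · rw [up_ne h.2.2.1.symm, up_self]
  · intro k hk
    simp only [Finset.mem_insert, Finset.mem_singleton, not_or] at hk
    rw [up_ne hk.1, up_ne hk.2]

theorem Conf.up_ne {σ : Finset (Fin N)} {c : Fin N → ℕ} {i j k : Fin N} (h : Conf π σ c i j)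
    (hi : i ≠ k) (hj : j ≠ k) : Conf π σ (up k c) i j := by
  refine ⟨h.1, h.2.1, h.2.2.1, ?_⟩
  rw [MC.up_ne hi, MC.up_ne hj]
  exact h.2.2.2

/-- The recursion defining the potential. -/
def IsF (π : Fin N → ℕ → Fin m) (σ : Finset (Fin N))
    (F : (Fin N → ℕ) → Finset (Fin m) → ℚ) : Prop :=
  (∀ c, (∀ i j, ¬ Conf π σ c i j) → F c = mono (σ.image fun i => π i (c i))) ∧
  (∀ c i j, Conf π σ c i j → F c = F (up i c) + F (up j c) - F (up i (up j c)))

open Classical in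
theorem exists_F (σ : Finset (Fin N)) (wf : WellFounded fun c' c => SubStep π σ c c') :
    ∃ F, IsF π σ F := by
  let step : (c : Fin N → ℕ) → ((c' : Fin N → ℕ) → SubStep π σ c c' → Finset (Fin m) → ℚ) →
      Finset (Fin m) → ℚ := fun c rec =>
    if h : ∃ p : Fin N × Fin N, Conf π σ c p.1 p.2 then
      rec (up h.choose.1 c) h.choose_spec.step1 + rec (up h.choose.2 c) h.choose_spec.symm.step1
        - rec (up h.choose.1 (up h.choose.2 c)) h.choose_spec.step2
    else mono (σ.image fun i => π i (c i))
  let F := wf.fix step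
  have hF : ∀ c, F c = step c (fun c' _ => F c') := fun c => wf.fix_eq step c
  have hF1 : ∀ c, (∀ i j, ¬ Conf π σ c i j) → F c = mono (σ.image fun i => π i (c i)) := by
    intro c hc
    rw [hF]
    have : ¬ ∃ p : Fin N × Fin N, Conf π σ c p.1 p.2 := fun ⟨p, hp⟩ => hc _ _ hp
    simp only [step, dif_neg this]
  have hF2 : ∀ c, (∃ i j, Conf π σ c i j) → ∃ i j, Conf π σ c i j ∧
      F c = F (up i c) + F (up j c) - F (up i (up j c)) := by
    intro c ⟨i, j, hij⟩
    have h : ∃ p : Fin N × Fin N, Conf π σ c p.1 p.2 := ⟨(i, j), hij⟩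
    refine ⟨h.choose.1, h.choose.2, h.choose_spec, ?_⟩
    conv_lhs => rw [hF]
    simp only [step, dif_pos h]
  refine ⟨F, hF1, ?_⟩
  intro c
  induction c using wf.induction with
  | _ c ih =>
  intro i j hij
  obtain ⟨a, b, hab, e⟩ := hF2 c ⟨i, j, hij⟩
  -- the case where one player is shared
  have share : ∀ i j b : Fin N, Conf π σ c i j → Conf π σ c i b → j ≠ b →
      F (up i c) + F (up b c) - F (up i (up b c)) =
        F (up i c) + F (up j c) - F (up i (up j c)) := by
    intro i j b hij hib hjb
    have e1 := ih (up b c) hib.symm.step1 i j (hij.up_ne hib.2.2.1 hjb)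
    have e2 := ih (up j c) hij.symm.step1 i b (hib.up_ne hij.2.2.1 hjb.symm)
    rw [e1, e2, up_comm b j c]
    abel
  by_cases hai : a = i
  · subst hai
    by_cases hbj : b = j
    · subst hbj; exact e
    · rw [e]; exact share a j b hij hab (Ne.symm hbj)
  by_cases haj : a = j
  · subst haj
    by_cases hbi : b = i
    · subst hbi; rw [e, up_comm]; abel
    · rw [e, share a i b hij.symm hab (Ne.symm hbi), up_comm i a]; abel
  by_cases hbi : b = i
  · subst hbi
    have := share b j a hij hab.symm (Ne.symm haj)
    rw [e, ← this, up_comm]; abel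
  by_cases hbj : b = j
  · subst hbj
    have := share b i a hij.symm hab.symm (Ne.symm hai)
    rw [e, up_comm i b, up_comm a b, add_comm (F (up i c)), ← this]; abel
  · have i1 := ih _ hab.step1 i j (hij.up_ne (Ne.symm hai) (Ne.symm haj))
    have i2 := ih _ hab.symm.step1 i j (hij.up_ne (Ne.symm hbi) (Ne.symm hbj))
    have i3 := ih _ hab.step2 i j
      ((hij.up_ne (Ne.symm hbi) (Ne.symm hbj)).up_ne (Ne.symm hai) (Ne.symm haj))
    have j1 := ih _ hij.step1 a b (hab.up_ne hai hbi)
    have j2 := ih _ hij.symm.step1 a b (hab.up_ne haj hbj)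
    have j3 := ih _ hij.step2 a b ((hab.up_ne haj hbj).up_ne hai hbi)
    rw [e, i1, i2, i3, j1, j2, j3]
    simp only [up_comm a i, up_comm a j, up_comm b i, up_comm b j]
    abel

theorem F_congr {σ : Finset (Fin N)} (wf : WellFounded fun c' c => SubStep π σ c c')
    {F : (Fin N → ℕ) → Finset (Fin m) → ℚ} (hF : IsF π σ F) :
    ∀ c c' : Fin N → ℕ, (∀ i ∈ σ, c i = c' i) → F c = F c' := by
  intro c
  induction c using wf.induction with
  | _ c ih =>
  intro c' h
  have hup : ∀ (c c' : Fin N → ℕ), (∀ i ∈ σ, c i = c' i) → ∀ k, ∀ i ∈ σ, up k c i = up k c' i := by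
    intro c c' h k i hi
    by_cases hik : i = k
    · subst hik; rw [up_self, up_self, h i hi]
    · rw [up_ne hik, up_ne hik, h i hi]
  by_cases hc : ∃ i j, Conf π σ c i j
  · obtain ⟨i, j, hij⟩ := hc
    have hij' : Conf π σ c' i j :=
      ⟨hij.1, hij.2.1, hij.2.2.1, by rw [← h i hij.1, ← h j hij.2.1]; exact hij.2.2.2⟩
    rw [hF.2 c i j hij, hF.2 c' i j hij', ih _ hij.step1 _ (hup _ _ h i),
      ih _ hij.symm.step1 _ (hup _ _ h j), ih _ hij.step2 _ (hup _ _ (hup _ _ h j) i)]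
  · push Not at hc
    have hc' : ∀ i j, ¬ Conf π σ c' i j := fun i j hij => hc i j
      ⟨hij.1, hij.2.1, hij.2.2.1, by rw [h i hij.1, h j hij.2.1]; exact hij.2.2.2⟩
    rw [hF.1 c hc, hF.1 c' hc']
    congr 1
    exact Finset.image_congr fun i hi => by rw [h i hi]

theorem F_supp {σ : Finset (Fin N)} (wf : WellFounded fun c' c => SubStep π σ c c')
    {F : (Fin N → ℕ) → Finset (Fin m) → ℚ} (hF : IsF π σ F) (A : Finset (Fin m))
    (hA : ∀ i ∈ σ, ∀ k, π i k ∈ A) :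
    ∀ c T, F c T ≠ 0 → T ⊆ A ∧ T.card = σ.card := by
  intro c
  induction c using wf.induction with
  | _ c ih =>
  intro T hT
  by_cases hc : ∃ i j, Conf π σ c i j
  · obtain ⟨i, j, hij⟩ := hc
    by_contra hcon
    have z1 : F (up i c) T = 0 := by by_contra h; exact hcon (ih _ hij.step1 T h)
    have z2 : F (up j c) T = 0 := by by_contra h; exact hcon (ih _ hij.symm.step1 T h)
    have z3 : F (up i (up j c)) T = 0 := by by_contra h; exact hcon (ih _ hij.step2 T h)
    rw [hF.2 c i j hij] at hT
    simp [z1, z2, z3] at hT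
  · push Not at hc
    rw [hF.1 c hc, mono] at hT
    have hT' : T = σ.image fun i => π i (c i) := by
      by_contra h; simp [h] at hT
    rw [hT']
    constructor
    · intro x hx
      obtain ⟨i, hi, rfl⟩ := Finset.mem_image.1 hx
      exact hA i hi _
    · apply Finset.card_image_of_injOn
      intro i hi j hj hij
      by_contra hne
      exact hc i j ⟨hi, hj, hne, hij⟩

theorem SubStep.mono {σ τ : Finset (Fin N)} (h : σ ⊆ τ) {c c' : Fin N → ℕ}
    (hs : SubStep π σ c c') : SubStep π τ c c' := by
  obtain ⟨T, h1, h2, h3, h4, h5⟩ := hs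
  refine ⟨T, h1.trans h, h2, ?_, h4, h5⟩
  intro i hi
  obtain ⟨j, hj, hj'⟩ := h3 i hi
  exact ⟨j, h hj, hj'⟩

theorem D_F {σ : Finset (Fin N)} (F : Finset (Fin N) → (Fin N → ℕ) → Finset (Fin m) → ℚ)
    (wf : ∀ τ, τ ⊆ σ → WellFounded fun c' c => SubStep π τ c c')
    (hF : ∀ τ, τ ⊆ σ → IsF π τ (F τ)) :
    ∀ c, D (F σ c) = ∑ k ∈ σ, F (σ.erase k) c := by
  intro c
  induction c using (wf σ (Finset.Subset.refl _)).induction with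
  | _ c ih =>
  have hσ := hF σ (Finset.Subset.refl _)
  by_cases hc : ∃ i j, Conf π σ c i j
  · obtain ⟨i, j, hij⟩ := hc
    rw [hσ.2 c i j hij, map_sub, map_add, ih _ hij.step1, ih _ hij.symm.step1, ih _ hij.step2,
      ← Finset.sum_add_distrib, ← Finset.sum_sub_distrib]
    refine Finset.sum_congr rfl fun k _ => ?_
    have hk := Finset.erase_subset k σ
    have irr : ∀ c', F (σ.erase k) (up k c') = F (σ.erase k) c' := fun c' =>
      F_congr (wf _ hk) (hF _ hk) _ _ fun l hl => up_ne (Finset.ne_of_mem_erase hl) _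
    by_cases hki : k = i
    · subst hki
      rw [irr, irr]; abel
    · by_cases hkj : k = j
      · subst hkj
        rw [up_comm, irr, irr]; abel
      · rw [(hF _ hk).2 c i j ⟨Finset.mem_erase.2 ⟨Ne.symm hki, hij.1⟩,
          Finset.mem_erase.2 ⟨Ne.symm hkj, hij.2.1⟩, hij.2.2⟩]
  · push Not at hc
    have hinj : ∀ i ∈ σ, ∀ j ∈ σ, π i (c i) = π j (c j) → i = j := by
      intro i hi j hj h
      by_contra hne
      exact hc i j ⟨hi, hj, hne, h⟩
    rw [hσ.1 c hc, D_mono, Finset.sum_image hinj]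
    refine Finset.sum_congr rfl fun k hkσ => ?_
    have hk := Finset.erase_subset k σ
    rw [(hF _ hk).1 c fun i j h => hc i j ⟨hk h.1, hk h.2.1, h.2.2⟩]
    congr 1
    ext x
    simp only [Finset.mem_erase, Finset.mem_image]
    constructor
    · rintro ⟨h1, i, hi, rfl⟩
      exact ⟨i, ⟨fun e => h1 (by rw [e]), hi⟩, rfl⟩
    · rintro ⟨i, ⟨h1, hi⟩, rfl⟩
      exact ⟨fun e => h1 (hinj i hi k hkσ e), i, hi, rfl⟩

end Game

end MC

/-- For every collection of `N = 2n-1` infinite words over `m = 2n-2` chairs (no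
fullness assumed), there is a choice of `n` of the words and starting locations for
which the scheduler wins, i.e. produces an infinite run. -/
theorem stmt_10 (n : ℕ) (hn : 2 ≤ n)
    (π : Fin (2 * n - 1) → ℕ → Fin (2 * n - 2)) :
    ∃ S : Finset (Fin (2 * n - 1)), S.card = n ∧
      ∃ f : ℕ → (Fin (2 * n - 1) → ℕ), ∀ t, SubStep π S (f t) (f (t + 1)) := by
  classical
  by_contra hcon
  push Not at hcon
  have wf : ∀ σ : Finset (Fin (2 * n - 1)), σ.card ≤ n →
      WellFounded fun c' c => SubStep π σ c c' := by
    intro σ hσ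
    obtain ⟨S, hS, hSn⟩ := Finset.exists_superset_card_eq hσ (by simp; omega)
    rw [wellFounded_iff_isEmpty_descending_chain]
    refine ⟨fun ⟨f, hf⟩ => ?_⟩
    obtain ⟨t, ht⟩ := hcon S hSn f
    exact ht (MC.SubStep.mono hS (hf t))
  have hex : ∀ σ : Finset (Fin (2 * n - 1)), ∃ F : (Fin (2 * n - 1) → ℕ) → Finset (Fin (2 * n - 2)) → ℚ,
      σ.card ≤ n → MC.IsF π σ F := by
    intro σ
    by_cases h : σ.card ≤ n
    · obtain ⟨F, hF⟩ := MC.exists_F σ (wf σ h)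
      exact ⟨F, fun _ => hF⟩
    · exact ⟨fun _ _ => 0, fun h' => absurd h' h⟩
  choose F hF using hex
  -- a minimal violator of Hall's condition
  let A : Fin (2 * n - 1) → Finset (Fin (2 * n - 2)) := fun i =>
    Finset.univ.filter fun x => ∃ k, π i k = x
  have hviol : ∃ q, ∃ U : Finset (Fin (2 * n - 1)), U.card = q ∧ (U.biUnion A).card < U.card := by
    refine ⟨_, Finset.univ, rfl, ?_⟩
    refine lt_of_le_of_lt (Finset.card_le_univ _) ?_
    simp
    omega
  obtain ⟨U, hUq, hU⟩ := Nat.find_spec hviol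
  have hmin : ∀ V : Finset (Fin (2 * n - 1)), V.card < U.card → V.card ≤ (V.biUnion A).card := by
    intro V hV
    by_contra h
    rw [hUq] at hV
    exact Nat.find_min hviol hV ⟨V, rfl, by omega⟩
  obtain ⟨w, hw⟩ : U.Nonempty := Finset.card_pos.1 (by omega)
  have hcard := Finset.card_erase_of_mem hw
  have hUpos : 0 < U.card := Finset.card_pos.2 ⟨w, hw⟩
  have hXle := hmin (U.erase w) (by omega)
  have hsubN : ((U.erase w).biUnion A).card ≤ (U.biUnion A).card :=
    Finset.card_le_card (Finset.biUnion_subset_biUnion_of_subset_left _ (Finset.erase_subset _ _))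
  have hall : ∃ f : {i // i ∈ U.erase w} → Fin (2 * n - 2), Function.Injective f ∧
      ∀ i, f i ∈ A i.1 := by
    rw [← Finset.all_card_le_biUnion_card_iff_exists_injective (fun i : {i // i ∈ U.erase w} => A i.1)]
    intro s
    have h1 : (s.map (Function.Embedding.subtype _)).card = s.card := Finset.card_map _
    have h2 : s.map (Function.Embedding.subtype _) ⊆ U.erase w := by
      intro x hx
      obtain ⟨y, _, rfl⟩ := Finset.mem_map.1 hx
      exact y.2
    have h3 := hmin (s.map (Function.Embedding.subtype _))
      (by have := Finset.card_le_card h2; omega)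
    rw [h1, Finset.map_eq_image, Finset.image_biUnion] at h3
    exact h3
  obtain ⟨f, hfi, hfA⟩ := hall
  have hk : ∀ i : Fin (2 * n - 1), ∃ k, ∀ h : i ∈ U.erase w, π i k = f ⟨i, h⟩ := by
    intro i
    by_cases h : i ∈ U.erase w
    · have := hfA ⟨i, h⟩
      simp only [A, Finset.mem_filter] at this
      obtain ⟨k, hk⟩ := this.2
      exact ⟨k, fun _ => hk⟩
    · exact ⟨0, fun h' => absurd h' h⟩
  choose c0 hc0 using hk
  have hinj : Set.InjOn (fun i => π i (c0 i)) (U.erase w : Finset _) := by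
    intro i hi j hj hij
    simp only at hij
    rw [hc0 i hi, hc0 j hj] at hij
    exact congrArg Subtype.val (hfi hij)
  have hA2 : (U.biUnion A).card ≤ 2 * n - 2 := by
    simpa using Finset.card_le_univ (U.biUnion A)
  refine MC.no_P (fun σ => F σ c0) n (U.biUnion A) U (U.erase w) (fun i => π i (c0 i))
    (Finset.erase_subset _ _) (by omega) (by omega) (by omega) hinj ?_ ?_ ?_
  · intro σ hσ hσn
    refine (hF σ hσn).1 c0 fun i j h => ?_
    exact h.2.2.1 (hinj (hσ h.1) (hσ h.2.1) h.2.2.2)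
  · intro σ hσ hσn
    refine MC.F_supp (wf σ hσn) (hF σ hσn) _ ?_ c0
    intro i hi k
    exact Finset.mem_biUnion.2 ⟨i, hσ hi, by simp [A]⟩
  · intro σ hσn
    exact MC.D_F F (fun τ hτ => wf τ ((Finset.card_le_card hτ).trans hσn))
      (fun τ hτ => hF τ ((Finset.card_le_card hτ).trans hσn)) c0
end
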